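/- (Exact decomposition of the right spectral embedding error.) In the truncated SVD setup, for every matrix W ∈ ℝ^{d×d} the following exact identity holds: V_A D_A^{1/2} − V_P D_P^{1/2} W = (A − P)ᵀ U_P D_P^{−1/2} W + S₁ + S₂ + S₃ + S₄, where S₁ = V_P ( V_Pᵀ V_A D_A^{1/2} − D_P^{1/2} W ), S₂ = (I − V_P V_Pᵀ)(A − P)ᵀ (U_A − U_P W) D_A^{−1/2}, S₃ = − V_P V_Pᵀ (A − P)ᵀ U_P W D_A^{−1/2}, and S₄ = (A − P)ᵀ U_P ( W D_A^{−1/2} − D_P^{−1/2} W ). -/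

import Mathlib

open Matrix

noncomputable section

/-- Entrywise square root of (the diagonal of) a diagonal matrix. -/
def dsqrt {d : ℕ} (D : Matrix (Fin d) (Fin d) ℝ) : Matrix (Fin d) (Fin d) ℝ :=
  Matrix.diagonal fun i => Real.sqrt (D i i)

/-- Entrywise inverse square root of (the diagonal of) a diagonal matrix. -/
def dinvsqrt {d : ℕ} (D : Matrix (Fin d) (Fin d) ℝ) : Matrix (Fin d) (Fin d) ℝ :=
  Matrix.diagonal fun i => (Real.sqrt (D i i))⁻¹

/-- A diagonal matrix times its inverse square root is its square root. -/
theorem diagonal_mul_dinvsqrt {d : ℕ} (f : Fin d → ℝ) :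
    diagonal f * dinvsqrt (diagonal f) = dsqrt (diagonal f) := by
  simp only [dinvsqrt, dsqrt, diagonal_apply_eq, diagonal_mul_diagonal]
  congr 1
  funext i
  rw [← div_eq_mul_inv, Real.div_sqrt]

/-- **Exact decomposition of the right spectral embedding error.**
In the truncated SVD setup, for every `W ∈ ℝ^{d×d}`,
`Vₐ Dₐ^{1/2} − V_P D_P^{1/2} W = (A − P)ᵀ U_P D_P^{−1/2} W + S₁ + S₂ + S₃ + S₄`. -/
theorem right_embedding_error_decomposition {d m p : ℕ}
    (A P : Matrix (Fin m) (Fin p) ℝ)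
    (DA DP : Matrix (Fin d) (Fin d) ℝ)
    (UA UP : Matrix (Fin m) (Fin d) ℝ)
    (VA VP : Matrix (Fin p) (Fin d) ℝ)
    (hDA : ∃ f : Fin d → ℝ, (∀ i, 0 < f i) ∧ DA = Matrix.diagonal f)
    (hDP : ∃ g : Fin d → ℝ, (∀ i, 0 < g i) ∧ DP = Matrix.diagonal g)
    (hUA : UAᵀ * UA = 1) (hVA : VAᵀ * VA = 1)
    (hAVA : A * VA = UA * DA) (hAUA : Aᵀ * UA = VA * DA)
    (hUP : UPᵀ * UP = 1) (hVP : VPᵀ * VP = 1)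
    (hP : P = UP * DP * VPᵀ)
    (W : Matrix (Fin d) (Fin d) ℝ) :
    VA * dsqrt DA - VP * dsqrt DP * W =
      (A - P)ᵀ * UP * dinvsqrt DP * W
        + VP * (VPᵀ * VA * dsqrt DA - dsqrt DP * W)
        + (1 - VP * VPᵀ) * (A - P)ᵀ * (UA - UP * W) * dinvsqrt DA
        + (-(VP * VPᵀ * (A - P)ᵀ * UP * W * dinvsqrt DA))
        + (A - P)ᵀ * UP * (W * dinvsqrt DA - dinvsqrt DP * W) := by
  obtain ⟨f, -, rfl⟩ := hDA
  have hresidual : (1 - VP * VPᵀ) * (A - P)ᵀ = (1 - VP * VPᵀ) * Aᵀ := by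
    have hVPproj : VP * VPᵀ * (VP * (DPᵀ * UPᵀ)) = VP * (DPᵀ * UPᵀ) := by
      rw [Matrix.mul_assoc, ← Matrix.mul_assoc VPᵀ, hVP, Matrix.one_mul]
    have hPt : Pᵀ = VP * (DPᵀ * UPᵀ) := by
      rw [hP, Matrix.transpose_mul, Matrix.transpose_mul, Matrix.transpose_transpose]
    rw [Matrix.transpose_sub, Matrix.mul_sub, hPt, Matrix.sub_mul 1 _ (VP * _), hVPproj,
      Matrix.one_mul, sub_self, sub_zero]
  have hmain : (1 - VP * VPᵀ) * (A - P)ᵀ * UA * dinvsqrt (diagonal f) =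
      VA * dsqrt (diagonal f) - VP * VPᵀ * VA * dsqrt (diagonal f) := by
    rw [hresidual, Matrix.mul_assoc _ Aᵀ, hAUA, Matrix.mul_assoc, Matrix.mul_assoc VA,
      diagonal_mul_dinvsqrt f, Matrix.sub_mul, Matrix.one_mul, ← Matrix.mul_assoc]
  have hsplit : (1 - VP * VPᵀ) * (A - P)ᵀ * (UA - UP * W) * dinvsqrt (diagonal f) =
      (1 - VP * VPᵀ) * (A - P)ᵀ * UA * dinvsqrt (diagonal f)
        - ((A - P)ᵀ * UP * W * dinvsqrt (diagonal f)
          - VP * VPᵀ * (A - P)ᵀ * UP * W * dinvsqrt (diagonal f)) := by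
    simp only [Matrix.mul_sub, Matrix.sub_mul, Matrix.one_mul, Matrix.mul_assoc]
  rw [hsplit, hmain, Matrix.mul_sub, Matrix.mul_sub]
  simp only [← Matrix.mul_assoc]
  abel
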